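/- arXiv:1604.07924 — 8 statements merged into one kernel-verified Lean document; each statement's English description precedes it below -/
import Mathlib

section
/- Let p : ℝ → ℝ be concave on [0,∞) and monotone nondecreasing on [0,∞), and suppose p has a finite right derivative c > 0 at 0. Then the function on ℝⁿ defined by x ↦ c·Σᵢ₌₁ⁿ |xᵢ| − Σᵢ₌₁ⁿ p(|xᵢ|) is convex. -/
theorem ConvexOn.comp_abs {q : ℝ → ℝ} (hq : ConvexOn ℝ (Set.Ici 0) q)
    (hmono : MonotoneOn q (Set.Ici 0)) : ConvexOn ℝ Set.univ fun t => q |t| := by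
  refine ⟨convex_univ, fun x _ y _ a b ha hb hab => ?_⟩
  have h : |a • x + b • y| ≤ a • |x| + b • |y| := by
    simpa [abs_mul, abs_of_nonneg ha, abs_of_nonneg hb] using abs_add_le (a • x) (b • y)
  exact (hmono (Set.mem_Ici.2 (abs_nonneg _)) (Set.mem_Ici.2 ((abs_nonneg _).trans h)) h).trans
    (hq.2 (abs_nonneg x) (abs_nonneg y) ha hb hab)

theorem ConcaveOn.sub_le_mul_sub_of_hasDerivWithinAt_zero {p : ℝ → ℝ} {c s t : ℝ}
    (hp : ConcaveOn ℝ (Set.Ici 0) p) (hderiv : HasDerivWithinAt p c (Set.Ici 0) 0)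
    (hs : 0 ≤ s) (hst : s ≤ t) : p t - p s ≤ c * (t - s) := by
  rcases hst.eq_or_lt with rfl | hst
  · simp
  have ht : 0 < t := hs.trans_lt hst
  rw [← div_le_iff₀ (sub_pos.2 hst)]
  have h0 : slope p 0 t ≤ c :=
    hp.slope_le_of_hasDerivWithinAt Set.self_mem_Ici ht.le ht hderiv
  rcases hs.eq_or_lt with rfl | hs
  · simpa [slope_def_field] using h0
  have h1 : slope p 0 s ≤ c :=
    hp.slope_le_of_hasDerivWithinAt Set.self_mem_Ici hs.le hs hderiv
  rw [slope_def_field] at h1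
  exact (hp.slope_anti_adjacent Set.self_mem_Ici ht.le hs hst).trans h1

/-- If `p : ℝ → ℝ` is concave and monotone nondecreasing on `[0, ∞)` and has
finite right derivative `c > 0` at `0`, then `x ↦ c • ∑ i, |x i| − ∑ i, p |x i|` is convex
on `ℝⁿ`. -/
theorem stmt0 (n : ℕ) (p : ℝ → ℝ) (c : ℝ)
    (hconc : ConcaveOn ℝ (Set.Ici (0 : ℝ)) p)
    (hmono : MonotoneOn p (Set.Ici (0 : ℝ)))
    (hc : 0 < c)
    (hderiv : HasDerivWithinAt p c (Set.Ici (0 : ℝ)) 0) :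
    ConvexOn ℝ (Set.univ : Set (Fin n → ℝ))
      (fun x => c * (∑ i, |x i|) - ∑ i, p |x i|) := by
  have hq : ConvexOn ℝ (Set.Ici 0) fun t => c * t - p t :=
    ((convexOn_id (convex_Ici 0)).smul hc.le).sub hconc
  have hqmono : MonotoneOn (fun t => c * t - p t) (Set.Ici 0) := fun s hs t _ hst => by
    have := hconc.sub_le_mul_sub_of_hasDerivWithinAt_zero hderiv hs hst
    dsimp only
    linarith
  simp_rw [Finset.mul_sum, ← Finset.sum_sub_distrib]
  refine ⟨convex_univ, fun x _ y _ a b ha hb hab => ?_⟩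
  simp_rw [Finset.smul_sum, ← Finset.sum_add_distrib]
  exact Finset.sum_le_sum fun i _ =>
    (hq.comp_abs hqmono).2 (Set.mem_univ (x i)) (Set.mem_univ (y i)) ha hb hab
end

section
/- Let G, H : ℝⁿ → ℝ be convex, and let sequences (x⁽ᵏ⁾), (y⁽ᵏ⁾) in ℝⁿ satisfy: y⁽ᵏ⁾ ∈ ∂H(x⁽ᵏ⁾) and x⁽ᵏ⁺¹⁾ is a global minimizer of z ↦ G(z) − (H(x⁽ᵏ⁾) + ⟨y⁽ᵏ⁾, z − x⁽ᵏ⁾⟩), for every k. If F := G − H is bounded from below on ℝⁿ, then the sequence (F(x⁽ᵏ⁾)) is nonincreasing and convergent. -/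
/-- DCA objective convergence: Let `G H : ℝⁿ → ℝ` be convex and let the
sequences `(x k)`, `(y k)` satisfy `y k ∈ ∂H (x k)` and `x (k+1)` a global minimizer of
`z ↦ G z - (H (x k) + ⟨y k, z - x k⟩)` for every `k`. If `F := G - H` is bounded below,
then `(F (x k))` is nonincreasing and convergent. -/
theorem stmt5 (n : ℕ) (G H : (Fin n → ℝ) → ℝ)
    (hG : ConvexOn ℝ (Set.univ : Set (Fin n → ℝ)) G)
    (hH : ConvexOn ℝ (Set.univ : Set (Fin n → ℝ)) H)
    (x y : ℕ → (Fin n → ℝ))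
    (hy : ∀ k : ℕ, ∀ z : Fin n → ℝ,
      H (x k) + ∑ i, y k i * (z i - x k i) ≤ H z)
    (hmin : ∀ k : ℕ, ∀ z : Fin n → ℝ,
      G (x (k + 1)) - (H (x k) + ∑ i, y k i * (x (k + 1) i - x k i)) ≤
        G z - (H (x k) + ∑ i, y k i * (z i - x k i)))
    (hbdd : ∃ B : ℝ, ∀ z : Fin n → ℝ, B ≤ G z - H z) :
    Antitone (fun k => G (x k) - H (x k)) ∧
      ∃ L : ℝ, Filter.Tendsto (fun k => G (x k) - H (x k)) Filter.atTop (nhds L) := by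
  have hanti : Antitone (fun k => G (x k) - H (x k)) := by
    refine antitone_nat_of_succ_le fun k => ?_
    have hsub := hy k (x (k + 1))
    have hle := hmin k (x k)
    simp only [sub_self, mul_zero, Finset.sum_const_zero, add_zero] at hle
    linarith
  obtain ⟨B, hB⟩ := hbdd
  refine ⟨hanti, _, tendsto_atTop_ciInf hanti ⟨B, ?_⟩⟩
  rintro _ ⟨k, rfl⟩
  exact hB (x k)
end

section
/- Let A ∈ ℝ^{m×n} and let T ⊆ {1,…,n} be such that ‖h_T‖₁ < ‖h_{T^c}‖₁ for every nonzero h ∈ ker(A). Let x̄ ∈ ℝⁿ be supported on T, and let w ∈ ℝⁿ satisfy wᵢ = sgn(x̄ᵢ)·(1 − θᵢ) for some θᵢ ∈ [0,1] for every i (so in particular wᵢ = 0 for i ∉ T). Then x̄ is the unique global minimizer of the problem: minimize ‖x‖₁ − ⟨w, x⟩ subject to Ax = Ax̄. -/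
/-- Subtracting a subgradient-type linear term `sgn a * (1 - t)` from the absolute value leaves a
function that decreases from `a` to `x` by at most `|x - a|`. -/
theorem abs_sub_sign_mul_le {a x t : ℝ} (ht : t ∈ Set.Icc (0 : ℝ) 1) :
    |a| - Real.sign a * (1 - t) * a ≤ |x| - Real.sign a * (1 - t) * x + |x - a| := by
  obtain ⟨h0, h1⟩ := ht
  have hxa := mul_le_mul_of_nonneg_left (neg_abs_le (x - a)) h0
  have hax := mul_le_mul_of_nonneg_left (le_abs_self (x - a)) h0
  have habs := mul_le_mul_of_nonneg_right h1 (abs_nonneg (x - a))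
  have hx := le_abs_self x
  have hx' := neg_abs_le x
  rcases lt_trichotomy a 0 with ha | rfl | ha
  · rw [Real.sign_of_neg ha, abs_of_neg ha]
    linarith
  · simp only [Real.sign_zero, abs_zero, zero_mul, sub_zero]
    positivity
  · rw [Real.sign_of_pos ha, abs_of_pos ha]
    linarith

/-- If `A` satisfies the null space property on `T` (`‖h_T‖₁ < ‖h_{Tᶜ}‖₁` for
every nonzero `h ∈ ker A`), `x̄` is supported on `T`, and `w i = sgn(x̄ i) * (1 - θ i)` for
some `θ i ∈ [0,1]`, then `x̄` is the unique global minimizer of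
`‖x‖₁ - ⟨w, x⟩` subject to `A x = A x̄`. -/
theorem stmt7 (m n : ℕ) (A : Matrix (Fin m) (Fin n) ℝ) (T : Finset (Fin n))
    (hNSP : ∀ h : Fin n → ℝ, A.mulVec h = 0 → h ≠ 0 →
      ∑ i ∈ T, |h i| < ∑ i ∈ Tᶜ, |h i|)
    (xbar : Fin n → ℝ) (hsupp : ∀ i ∉ T, xbar i = 0)
    (w θ : Fin n → ℝ) (hθ : ∀ i, θ i ∈ Set.Icc (0 : ℝ) 1)
    (hw : ∀ i, w i = Real.sign (xbar i) * (1 - θ i)) :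
    ∀ x : Fin n → ℝ, A.mulVec x = A.mulVec xbar → x ≠ xbar →
      (∑ i, |xbar i|) - ∑ i, w i * xbar i < (∑ i, |x i|) - ∑ i, w i * x i := by
  intro x hx hne
  have hker : A.mulVec (x - xbar) = 0 := by rw [Matrix.mulVec_sub, hx, sub_self]
  have hlt := hNSP (x - xbar) hker (sub_ne_zero.mpr hne)
  have hT : ∑ i ∈ T, (|xbar i| - w i * xbar i) ≤
      ∑ i ∈ T, (|x i| - w i * x i) + ∑ i ∈ T, |(x - xbar) i| := by
    rw [← Finset.sum_add_distrib]
    refine Finset.sum_le_sum fun i _ => ?_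
    rw [hw i]
    exact abs_sub_sign_mul_le (hθ i)
  have hTc : ∑ i ∈ Tᶜ, (|xbar i| - w i * xbar i) = 0 :=
    Finset.sum_eq_zero fun i hi => by simp [hsupp i (Finset.mem_compl.mp hi)]
  have hTc' : ∑ i ∈ Tᶜ, (|x i| - w i * x i) = ∑ i ∈ Tᶜ, |(x - xbar) i| :=
    Finset.sum_congr rfl fun i hi => by simp [hw i, hsupp i (Finset.mem_compl.mp hi)]
  rw [← Finset.sum_sub_distrib, ← Finset.sum_sub_distrib,
    ← Finset.sum_add_sum_compl T, ← Finset.sum_add_sum_compl T (fun i => |x i| - w i * x i)]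
  linarith
end

section
/- Let A ∈ ℝ^{m×n} and let x̄ ∈ ℝⁿ be the unique minimizer of ‖x‖₁ subject to Ax = Ax̄. Let T = supp(x̄). Then for every nonzero h ∈ ker(A), −⟨sgn(x̄), h_T⟩ < ‖h_{T^c}‖₁. -/
theorem abs_add_eq_abs_add_sign_mul {x y : ℝ} (hx : x ≠ 0) (hxy : |y| ≤ |x|) :
    |x + y| = |x| + Real.sign x * y := by
  have hy := abs_le.mp hxy
  rcases lt_or_gt_of_ne hx with h | h
  · rw [abs_of_neg h] at hy ⊢
    rw [Real.sign_of_neg h, abs_of_nonpos (by linarith)]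
    ring
  · rw [abs_of_pos h] at hy ⊢
    rw [Real.sign_of_pos h, abs_of_nonneg (by linarith)]
    ring

theorem exists_pos_forall_abs_mul_le {ι : Type*} [Finite ι] (x h : ι → ℝ) :
    ∃ t : ℝ, 0 < t ∧ ∀ i, x i ≠ 0 → |t * h i| ≤ |x i| := by
  have hev : ∀ᶠ t in nhds (0 : ℝ), ∀ i, x i ≠ 0 → |t * h i| ≤ |x i| := by
    refine Filter.eventually_all.mpr fun i => ?_
    by_cases hi : x i = 0
    · simp [hi]
    · have hc : Continuous fun t : ℝ => |t * h i| := by fun_prop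
      have hlt := hc.continuousAt.eventually_lt (x₀ := (0 : ℝ)) continuousAt_const
        (by simpa using hi : |(0 : ℝ) * h i| < |x i|)
      exact hlt.mono fun t ht _ => ht.le
  obtain ⟨t, ht, hpos⟩ :=
    ((hev.filter_mono nhdsWithin_le_nhds).and (self_mem_nhdsWithin (s := Set.Ioi 0))).exists
  exact ⟨t, hpos, ht⟩


/-- If `x̄` is the unique minimizer of `‖x‖₁` subject to `A x = A x̄` and
`T = supp x̄`, then for every nonzero `h ∈ ker A`, `-⟨sgn x̄, h_T⟩ < ‖h_{Tᶜ}‖₁`. -/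
theorem stmt9 (m n : ℕ) (A : Matrix (Fin m) (Fin n) ℝ) (xbar : Fin n → ℝ)
    (hBP : ∀ x : Fin n → ℝ, A.mulVec x = A.mulVec xbar → x ≠ xbar →
      ∑ i, |xbar i| < ∑ i, |x i|)
    (T : Finset (Fin n)) (hT : T = Finset.univ.filter (fun i => xbar i ≠ 0)) :
    ∀ h : Fin n → ℝ, A.mulVec h = 0 → h ≠ 0 →
      -(∑ i ∈ T, Real.sign (xbar i) * h i) < ∑ i ∈ Tᶜ, |h i| := by
  intro h hA hne
  obtain ⟨t, ht, hle⟩ := exists_pos_forall_abs_mul_le xbar h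
  have hlt := hBP (xbar + t • h) (by simp [Matrix.mulVec_add, Matrix.mulVec_smul, hA])
    (by simp [ht.ne', hne])
  rw [← Finset.sum_add_sum_compl T, ← Finset.sum_add_sum_compl T fun i => |(xbar + t • h) i|] at hlt
  have hon : ∑ i ∈ T, |(xbar + t • h) i| =
      ∑ i ∈ T, |xbar i| + t * ∑ i ∈ T, Real.sign (xbar i) * h i := by
    rw [Finset.mul_sum, ← Finset.sum_add_distrib]
    refine Finset.sum_congr rfl fun i hi => ?_
    have hi' : xbar i ≠ 0 := by simpa [hT] using hi
    rw [Pi.add_apply, Pi.smul_apply, smul_eq_mul, abs_add_eq_abs_add_sign_mul hi' (hle i hi')]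
    ring
  have hoff : ∀ i ∈ Tᶜ, xbar i = 0 := fun i hi => by simpa [hT] using hi
  have hoff₁ : ∑ i ∈ Tᶜ, |xbar i| = 0 :=
    Finset.sum_eq_zero fun i hi => by simp [hoff i hi]
  have hoff₂ : ∑ i ∈ Tᶜ, |(xbar + t • h) i| = t * ∑ i ∈ Tᶜ, |h i| := by
    rw [Finset.mul_sum]
    exact Finset.sum_congr rfl fun i hi => by simp [hoff i hi, abs_mul, abs_of_pos ht]
  rw [hon, hoff₁, hoff₂] at hlt
  have hmul : 0 < t * (∑ i ∈ T, Real.sign (xbar i) * h i + ∑ i ∈ Tᶜ, |h i|) := by linarith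
  linarith [pos_of_mul_pos_right hmul ht.le]
end

section
/- Let A ∈ ℝ^{m×n} and let x̄ ∈ ℝⁿ be a nonzero signal with equal-height peaks, i.e. |x̄ᵢ| = |x̄ⱼ| for all i, j ∈ T where T = supp(x̄). Suppose x̄ is the unique minimizer of ‖x‖₁ subject to Ax = Ax̄. Let θ ∈ [0,1) and set w = (1 − θ)·sgn(x̄). Then x̄ is the unique minimizer of ‖x‖₁ − ⟨w, x⟩ subject to Ax = Ax̄. -/
/-- The one-sided directional derivative of `|·|` at `a` in direction `h`. -/
noncomputable def absDirDeriv (a h : ℝ) : ℝ := Real.sign a * h + if a = 0 then |h| else 0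

theorem abs_add_absDirDeriv_le (a h : ℝ) : |a| + absDirDeriv a h ≤ |a + h| := by
  unfold absDirDeriv
  rcases lt_trichotomy a 0 with ha | rfl | ha
  · rw [Real.sign_of_neg ha, if_neg ha.ne, abs_of_neg ha]
    linarith [neg_le_abs (a + h)]
  · simp
  · rw [Real.sign_of_pos ha, if_neg ha.ne', abs_of_pos ha]
    linarith [le_abs_self (a + h)]

theorem eventually_abs_add_mul_eq (a h : ℝ) :
    ∀ᶠ t in nhdsWithin (0 : ℝ) (Set.Ioi 0), |a + t * h| = |a| + t * absDirDeriv a h := by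
  have hcont : Filter.Tendsto (fun t : ℝ => a + t * h) (nhdsWithin 0 (Set.Ioi 0)) (nhds a) := by
    have hc : Continuous fun t : ℝ => a + t * h := by fun_prop
    simpa using (hc.tendsto 0).mono_left nhdsWithin_le_nhds
  unfold absDirDeriv
  rcases lt_trichotomy a 0 with ha | rfl | ha
  · filter_upwards [hcont.eventually_lt_const ha] with t ht
    rw [Real.sign_of_neg ha, if_neg ha.ne, abs_of_neg ha, abs_of_neg ht]
    ring
  · filter_upwards [self_mem_nhdsWithin] with t ht
    simp [abs_mul, abs_of_pos (Set.mem_Ioi.mp ht)]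
  · filter_upwards [hcont.eventually_const_lt ha] with t ht
    rw [Real.sign_of_pos ha, if_neg ha.ne', abs_of_pos ha, abs_of_pos ht]
    ring

/-- If `a` is the unique `ℓ₁` minimizer on its fibre, then the directional derivative of the
`ℓ₁` norm at `a` is positive along every nonzero kernel direction. -/
theorem sum_absDirDeriv_pos {ι κ : Type*} [Fintype ι] (A : Matrix κ ι ℝ) (a : ι → ℝ)
    (hmin : ∀ x : ι → ℝ, A.mulVec x = A.mulVec a → x ≠ a → ∑ i, |a i| < ∑ i, |x i|)
    (h : ι → ℝ) (hker : A.mulVec h = 0) (hh : h ≠ 0) :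
    0 < ∑ i, absDirDeriv (a i) (h i) := by
  obtain ⟨t, hsum, ht⟩ := ((Filter.eventually_all.2 fun i =>
    eventually_abs_add_mul_eq (a i) (h i)).and self_mem_nhdsWithin).exists
  have ht : 0 < t := ht
  have hlt := hmin (a + t • h) (by simp [Matrix.mulVec_add, Matrix.mulVec_smul, hker])
    (by simp [ht.ne', hh])
  simp only [Pi.add_apply, Pi.smul_apply, smul_eq_mul, hsum, Finset.sum_add_distrib,
    ← Finset.mul_sum] at hlt
  exact pos_of_mul_pos_right (by linarith) ht.le


/-- recovery of equal-height signals: Let `x̄ ≠ 0` have equal-height peaks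
(`|x̄ i| = |x̄ j|` whenever `x̄ i ≠ 0` and `x̄ j ≠ 0`), and suppose `x̄` is the unique
minimizer of `‖x‖₁` subject to `A x = A x̄`. Then for `θ ∈ [0,1)` and
`w = (1 - θ) • sgn x̄`, `x̄` is the unique minimizer of `‖x‖₁ - ⟨w, x⟩` subject to
`A x = A x̄`. -/
theorem stmt10 (m n : ℕ) (A : Matrix (Fin m) (Fin n) ℝ) (xbar : Fin n → ℝ)
    (hne : xbar ≠ 0)
    (hequal : ∀ i j : Fin n, xbar i ≠ 0 → xbar j ≠ 0 → |xbar i| = |xbar j|)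
    (hBP : ∀ x : Fin n → ℝ, A.mulVec x = A.mulVec xbar → x ≠ xbar →
      ∑ i, |xbar i| < ∑ i, |x i|)
    (θ : ℝ) (hθ : θ ∈ Set.Ico (0 : ℝ) 1)
    (w : Fin n → ℝ) (hw : ∀ i, w i = (1 - θ) * Real.sign (xbar i)) :
    ∀ x : Fin n → ℝ, A.mulVec x = A.mulVec xbar → x ≠ xbar →
      (∑ i, |xbar i|) - ∑ i, w i * xbar i < (∑ i, |x i|) - ∑ i, w i * x i := by
  intro x hx hxne
  obtain ⟨h, rfl⟩ : ∃ h, x = xbar + h := ⟨x - xbar, by simp⟩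
  have hh : h ≠ 0 := by simpa using hxne
  have hker : A.mulVec h = 0 := by simpa [Matrix.mulVec_add] using hx
  have hpos := sum_absDirDeriv_pos A xbar hBP h hker hh
  have hneg := sum_absDirDeriv_pos A xbar hBP (-h) (by simp [Matrix.mulVec_neg, hker])
    (by simpa using hh)
  have hle := Finset.sum_le_sum fun i (_ : i ∈ Finset.univ) =>
    abs_add_absDirDeriv_le (xbar i) (h i)
  simp only [absDirDeriv, Pi.neg_apply, abs_neg, mul_neg, Finset.sum_add_distrib,
    Finset.sum_neg_distrib] at hpos hneg hle
  simp only [hw, Pi.add_apply, mul_add, Finset.sum_add_distrib, mul_assoc, ← Finset.mul_sum]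
  obtain ⟨h0, h1⟩ := hθ
  nlinarith [mul_nonneg h0 hpos.le, mul_pos (sub_pos.2 h1) (add_pos hpos hneg)]
end

section
/- Let A ∈ ℝ^{m×n} and let T ⊆ {1,…,n} be such that ‖h_T‖₁ < ‖h_{T^c}‖₁ for every nonzero h ∈ ker(A). Let x̄ ∈ ℝⁿ be nonzero and supported on T. Then x̄ is the unique minimizer of ‖x‖₁ − ⟨x̄/‖x̄‖₂, x⟩ subject to Ax = Ax̄. -/
/-- Tilting the absolute value by the slope `a / s`, where `|a| ≤ s`, decreases it by at most
`|x - a|` between `a` and `x`. -/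
lemma neg_abs_sub_le_abs_sub_abs_sub_div_mul {a s : ℝ} (h : |a| ≤ s) (x : ℝ) :
    -|x - a| ≤ |x| - |a| - a / s * (x - a) := by
  have hs : 0 ≤ s := (abs_nonneg a).trans h
  have hle : |a / s| ≤ 1 := by
    rw [abs_div, abs_of_nonneg hs]
    exact div_le_one_of_le₀ h hs
  obtain ⟨hl, hr⟩ := abs_le.mp hle
  rcases le_total 0 a with ha | ha
  · have hw : 0 ≤ a / s := div_nonneg ha hs
    rw [abs_of_nonneg ha]
    rcases abs_cases (x - a) with ⟨h1, h2⟩ | ⟨h1, h2⟩ <;> rw [h1] <;>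
      nlinarith [le_abs_self x]
  · have hw : a / s ≤ 0 := div_nonpos_of_nonpos_of_nonneg ha hs
    rw [abs_of_nonpos ha]
    rcases abs_cases (x - a) with ⟨h1, h2⟩ | ⟨h1, h2⟩ <;> rw [h1] <;>
      nlinarith [neg_le_abs x]

/-- A coordinate is bounded by the Euclidean norm. -/
lemma abs_le_sqrt_sum_sq {ι : Type*} [Fintype ι] (v : ι → ℝ) (i : ι) :
    |v i| ≤ Real.sqrt (∑ j, v j ^ 2) :=
  Real.abs_le_sqrt (Finset.single_le_sum (f := fun j => v j ^ 2)
    (fun j _ => sq_nonneg (v j)) (Finset.mem_univ i))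


/-- DCA-ℓ₁₋₂ recovery: If `A` satisfies the null space property on `T` and
`x̄ ≠ 0` is supported on `T`, then `x̄` is the unique minimizer of
`‖x‖₁ - ⟨x̄ / ‖x̄‖₂, x⟩` subject to `A x = A x̄`. -/
theorem stmt11 (m n : ℕ) (A : Matrix (Fin m) (Fin n) ℝ) (T : Finset (Fin n))
    (hNSP : ∀ h : Fin n → ℝ, A.mulVec h = 0 → h ≠ 0 →
      ∑ i ∈ T, |h i| < ∑ i ∈ Tᶜ, |h i|)
    (xbar : Fin n → ℝ) (hne : xbar ≠ 0) (hsupp : ∀ i ∉ T, xbar i = 0) :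
    ∀ x : Fin n → ℝ, A.mulVec x = A.mulVec xbar → x ≠ xbar →
      (∑ i, |xbar i|) - ∑ i, (xbar i / Real.sqrt (∑ j, (xbar j) ^ 2)) * xbar i <
        (∑ i, |x i|) - ∑ i, (xbar i / Real.sqrt (∑ j, (xbar j) ^ 2)) * x i := by
  intro x hx hxne
  have hker := hNSP (x - xbar) (by rw [Matrix.mulVec_sub, hx, sub_self]) (sub_ne_zero.mpr hxne)
  simp only [Pi.sub_apply] at hker
  set s := Real.sqrt (∑ j, xbar j ^ 2)
  have hT : ∑ i ∈ T, -|x i - xbar i| ≤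
      ∑ i ∈ T, (|x i| - |xbar i| - xbar i / s * (x i - xbar i)) :=
    Finset.sum_le_sum fun i _ =>
      neg_abs_sub_le_abs_sub_abs_sub_div_mul (abs_le_sqrt_sum_sq xbar i) (x i)
  have hTc : ∑ i ∈ Tᶜ, |x i - xbar i| =
      ∑ i ∈ Tᶜ, (|x i| - |xbar i| - xbar i / s * (x i - xbar i)) :=
    Finset.sum_congr rfl fun i hi => by simp [hsupp i (Finset.mem_compl.mp hi)]
  have hsplit := Finset.sum_add_sum_compl T
    fun i => |x i| - |xbar i| - xbar i / s * (x i - xbar i)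
  rw [Finset.sum_neg_distrib] at hT
  simp only [mul_sub, Finset.sum_sub_distrib] at hT hTc hsplit
  linarith
end

section
/- Let p : ℝ → ℝ be concave on [0,∞) and monotone nondecreasing on [0,∞), with finite right derivative c > 0 at 0, and let D ∈ ℝ^{l×n} be any matrix. Then the function on ℝⁿ defined by x ↦ c·‖Dx‖₁ − Σᵢ₌₁ˡ p(|(Dx)ᵢ|) is convex. -/
/-- A convex function on `[0, ∞)` that is minimal at `0` is monotone there. -/
theorem ConvexOn.monotoneOn_Ici_zero_of_isMinOn {q : ℝ → ℝ}
    (hq : ConvexOn ℝ (Set.Ici (0 : ℝ)) q) (hmin : ∀ y, 0 ≤ y → q 0 ≤ q y) :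
    MonotoneOn q (Set.Ici (0 : ℝ)) := by
  intro x hx y hy hxy
  have hseg : x ∈ segment ℝ 0 y := by
    rw [segment_eq_Icc (Set.mem_Ici.1 hy)]
    exact ⟨hx, hxy⟩
  exact (hq.le_max_of_mem_segment Set.self_mem_Ici hy hseg).trans
    (max_le (hmin y hy) le_rfl)

/-- A concave function on `[0, ∞)` lies below its tangent line at `0`. -/
theorem ConcaveOn.sub_le_mul_of_hasDerivWithinAt_zero {p : ℝ → ℝ} {c : ℝ}
    (hconc : ConcaveOn ℝ (Set.Ici (0 : ℝ)) p)
    (hderiv : HasDerivWithinAt p c (Set.Ici (0 : ℝ)) 0) {y : ℝ} (hy : 0 ≤ y) :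
    p y - p 0 ≤ c * y := by
  rcases hy.eq_or_lt with rfl | hy
  · simp
  have h := hconc.slope_le_of_hasDerivWithinAt Set.self_mem_Ici (Set.mem_Ici.2 hy.le) hy hderiv
  rwa [slope_def_field, sub_zero, div_le_iff₀ hy] at h

/-- If `p` is concave on `[0, ∞)` with right derivative `c` at `0`, then `t ↦ c |t| - p |t|` is
convex on the whole line. -/
theorem ConcaveOn.convexOn_mul_abs_sub_comp_abs {p : ℝ → ℝ} {c : ℝ}
    (hconc : ConcaveOn ℝ (Set.Ici (0 : ℝ)) p)
    (hderiv : HasDerivWithinAt p c (Set.Ici (0 : ℝ)) 0) :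
    ConvexOn ℝ Set.univ (fun t : ℝ => c * |t| - p |t|) := by
  have hq : ConvexOn ℝ (Set.Ici (0 : ℝ)) (fun t => c * t - p t) :=
    ((LinearMap.mulLeft ℝ c).convexOn (convex_Ici 0)).sub hconc
  have hmono := hq.monotoneOn_Ici_zero_of_isMinOn fun y hy => by
    have := hconc.sub_le_mul_of_hasDerivWithinAt_zero hderiv hy
    simp only [mul_zero]
    linarith
  have habs : ConvexOn ℝ Set.univ (fun t : ℝ => |t|) := convexOn_univ_norm
  have himage : (fun t : ℝ => |t|) '' Set.univ = Set.Ici 0 := by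
    ext t
    simp only [Set.image_univ, Set.mem_range, Set.mem_Ici]
    exact ⟨fun ⟨s, hs⟩ => hs ▸ abs_nonneg s, fun ht => ⟨t, abs_of_nonneg ht⟩⟩
  rw [← himage] at hq hmono
  exact hq.comp habs hmono

/-- DC decomposition of `P(|Dx|)`: If `p : ℝ → ℝ` is concave and monotone
nondecreasing on `[0, ∞)` with finite right derivative `c > 0` at `0`, and
`D ∈ ℝ^{l×n}` is any matrix, then `x ↦ c * ‖D x‖₁ − ∑ i, p |(D x) i|` is convex. -/
theorem stmt13 (l n : ℕ) (p : ℝ → ℝ) (c : ℝ)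
    (hconc : ConcaveOn ℝ (Set.Ici (0 : ℝ)) p)
    (hmono : MonotoneOn p (Set.Ici (0 : ℝ)))
    (hc : 0 < c)
    (hderiv : HasDerivWithinAt p c (Set.Ici (0 : ℝ)) 0)
    (D : Matrix (Fin l) (Fin n) ℝ) :
    ConvexOn ℝ (Set.univ : Set (Fin n → ℝ))
      (fun x => c * (∑ i, |D.mulVec x i|) - ∑ i, p |D.mulVec x i|) := by
  have hterm (i : Fin l) : ConvexOn ℝ (Set.univ : Set (Fin n → ℝ))
      (fun x => c * |D.mulVec x i| - p |D.mulVec x i|) :=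
    (hconc.convexOn_mul_abs_sub_comp_abs hderiv).comp_linearMap
      ((LinearMap.proj i).comp D.mulVecLin)
  simp only [Finset.mul_sum, ← Finset.sum_sub_distrib]
  refine ⟨convex_univ, fun x hx y hy a b ha hb hab => ?_⟩
  simp only [smul_eq_mul, Finset.mul_sum, ← Finset.sum_add_distrib]
  exact Finset.sum_le_sum fun i _ => (hterm i).2 hx hy ha hb hab
end

section
/- Let A ∈ ℝ^{m×n} and T ⊆ {1,…,n}. If for every nonzero h ∈ ker(A) one has ‖h_T‖₁ < ‖h_{T^c}‖₁, then every x̄ ∈ ℝⁿ supported on T is the unique minimizer of ‖x‖₁ subject to Ax = Ax̄; conversely, if every x̄ supported on T is the unique minimizer of ‖x‖₁ subject to Ax = Ax̄, then ‖h_T‖₁ < ‖h_{T^c}‖₁ for every nonzero h ∈ ker(A). -/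
/-- null space property characterization of uniform ℓ₁ recovery: `A`
satisfies `‖h_T‖₁ < ‖h_{Tᶜ}‖₁` for every nonzero `h ∈ ker A` if and only if every `x̄`
supported on `T` is the unique minimizer of `‖x‖₁` subject to `A x = A x̄`. -/
theorem stmt14 (m n : ℕ) (A : Matrix (Fin m) (Fin n) ℝ) (T : Finset (Fin n)) :
    (∀ h : Fin n → ℝ, A.mulVec h = 0 → h ≠ 0 →
        ∑ i ∈ T, |h i| < ∑ i ∈ Tᶜ, |h i|) ↔
      (∀ xbar : Fin n → ℝ, (∀ i ∉ T, xbar i = 0) →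
        ∀ x : Fin n → ℝ, A.mulVec x = A.mulVec xbar → x ≠ xbar →
          ∑ i, |xbar i| < ∑ i, |x i|) := by
  constructor
  · intro hA xbar hsupp x hx hne
    have hlt := hA (x - xbar) (by rw [Matrix.mulVec_sub, hx, sub_self]) (sub_ne_zero.mpr hne)
    have hoff : ∑ i ∈ Tᶜ, |(x - xbar) i| = ∑ i ∈ Tᶜ, |x i| :=
      Finset.sum_congr rfl fun i hi => by
        rw [Pi.sub_apply, hsupp i (Finset.mem_compl.mp hi), sub_zero]
    have hzero : ∑ i ∈ Tᶜ, |xbar i| = 0 :=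
      Finset.sum_eq_zero fun i hi => by rw [hsupp i (Finset.mem_compl.mp hi), abs_zero]
    have htri : ∑ i ∈ T, |xbar i| ≤ ∑ i ∈ T, |x i| + ∑ i ∈ T, |(x - xbar) i| := by
      rw [← Finset.sum_add_distrib]
      refine Finset.sum_le_sum fun i _ => ?_
      simpa using abs_sub (x i) ((x - xbar) i)
    rw [← Finset.sum_add_sum_compl T fun i => |xbar i|,
      ← Finset.sum_add_sum_compl T fun i => |x i|]
    linarith
  · intro hmin h hker hne
    let x : Fin n → ℝ := fun i => if i ∈ T then 0 else h i
    let xbar : Fin n → ℝ := fun i => if i ∈ T then -h i else 0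
    have hdiff : x - xbar = h := by
      funext i
      by_cases hi : i ∈ T <;> simp [x, xbar, hi]
    have hlt := hmin xbar (fun i hi => by simp [xbar, hi]) x
      (by rw [← sub_eq_zero, ← Matrix.mulVec_sub, hdiff, hker])
      (by rw [← sub_ne_zero, hdiff]; exact hne)
    have hxbar : ∑ i, |xbar i| = ∑ i ∈ T, |h i| := by
      simp [xbar, apply_ite abs]
    have hx : ∑ i, |x i| = ∑ i ∈ Tᶜ, |h i| := by
      simp [x, apply_ite abs, Finset.sum_ite, Finset.compl_eq_univ_sdiff, Finset.sdiff_eq_filter]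
    rwa [hxbar, hx] at hlt
end
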